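/- Let F be a positive integer and let n_1 < n_2 < ... < n_p < F be positive integers with d = gcd{n_1,...,n_p} not dividing F. Then {n_1,...,n_p} is the minimal Sat(F)-system of generators of Sat(F)[{n_1,...,n_p}] if and only if gcd{n_1,...,n_i} ≠ gcd{n_1,...,n_{i+1}} for all i ∈ {1,...,p−1}. -/

import Mathlib

/-- A numerical semigroup: subset of ℕ containing 0, closed under addition,
with finite complement. -/
def IsNumericalSemigroup (S : Set ℕ) : Prop :=
  0 ∈ S ∧ (∀ a ∈ S, ∀ b ∈ S, a + b ∈ S) ∧ Sᶜ.Finite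

/-- `dOf S s = gcd {x ∈ S : x ≤ s}`. -/
noncomputable def dOf (S : Set ℕ) (s : ℕ) : ℕ :=
  letI := Classical.decPred (· ∈ S)
  ((Finset.range (s + 1)).filter (· ∈ S)).gcd id

/-- A saturated numerical semigroup. -/
def IsSaturatedNS (S : Set ℕ) : Prop :=
  IsNumericalSemigroup S ∧ ∀ s ∈ S, s ≠ 0 → s + dOf S s ∈ S

/-- `Sat F`: saturated numerical semigroups with Frobenius number `F`. -/
def SatF (F : ℕ) : Set (Set ℕ) :=
  {S | IsSaturatedNS S ∧ F ∉ S ∧ ∀ x, x ∉ S → x ≤ F}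

/-- Multiplicity: least nonzero element. -/
noncomputable def multOf (S : Set ℕ) : ℕ := sInf {x | x ∈ S ∧ x ≠ 0}

/-- Pseudo-Frobenius numbers. -/
def PFset (S : Set ℕ) : Set ℕ := {z | z ∉ S ∧ ∀ s ∈ S, s ≠ 0 → z + s ∈ S}

/-- Special gaps. -/
def SGset (S : Set ℕ) : Set ℕ := {x | x ∈ PFset S ∧ 2 * x ∈ S}

/-- `TSet a b = ⟨a⟩ ∪ {x : x ≥ b}`. -/
def TSet (a b : ℕ) : Set ℕ := {x | a ∣ x} ∪ {x | b ≤ x}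

/-- A `Sat(F)`-set. -/
def SatFSet (F : ℕ) (X : Set ℕ) : Prop :=
  X ∩ ({0} ∪ {x | F + 1 ≤ x}) = ∅ ∧ ∃ S ∈ SatF F, X ⊆ S

/-- `Sat(F)[X]`: intersection of all elements of `Sat F` containing `X`. -/
def SatClosure (F : ℕ) (X : Set ℕ) : Set ℕ := ⋂₀ {S | S ∈ SatF F ∧ X ⊆ S}

/-- `X` is a minimal `Sat(F)`-system of generators of `S`. -/
def IsMinSatGen (F : ℕ) (X S : Set ℕ) : Prop :=
  SatFSet F X ∧ SatClosure F X = S ∧ ∀ Y : Set ℕ, Y ⊂ X → SatClosure F Y ≠ S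

/-- The `Sat(F)`-rank of `S`: minimal cardinality of a `Sat(F)`-set `X`
with `Sat(F)[X] = S`. -/
noncomputable def SatRank (F : ℕ) (S : Set ℕ) : ℕ :=
  sInf {k | ∃ X : Set ℕ, SatFSet F X ∧ SatClosure F X = S ∧ X.ncard = k}

theorem dvd_dOf_iff {S : Set ℕ} {m s : ℕ} : m ∣ dOf S s ↔ ∀ x ∈ S, x ≤ s → m ∣ x := by
  classical
  simp only [dOf, Finset.dvd_gcd_iff, Finset.mem_filter, Finset.mem_range, id, Nat.lt_succ_iff]
  exact ⟨fun h x hx hs => h x ⟨hs, hx⟩, fun h x hx => h x hx.2 hx.1⟩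

theorem dOf_dvd {S : Set ℕ} {x s : ℕ} (hx : x ∈ S) (hs : x ≤ s) : dOf S s ∣ x :=
  dvd_dOf_iff.1 dvd_rfl x hx hs

theorem dOf_dvd_dOf {S : Set ℕ} {s t : ℕ} (h : s ≤ t) : dOf S t ∣ dOf S s :=
  dvd_dOf_iff.2 fun _ hx hxs => dOf_dvd hx (hxs.trans h)

/-- The elements of a saturated semigroup above `s` include every `s + g` with `d_S(s) ∣ g`. -/
theorem IsSaturatedNS.add_mem_of_dOf_dvd {S : Set ℕ} (hS : IsSaturatedNS S) (g : ℕ) :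
    ∀ s ∈ S, s ≠ 0 → dOf S s ∣ g → s + g ∈ S := by
  induction g using Nat.strong_induction_on with
  | _ g ih =>
    intro s hs hs0 hg
    rcases Nat.eq_zero_or_pos g with rfl | hgpos
    · simpa using hs
    have hle : dOf S s ≤ g := Nat.le_of_dvd hgpos hg
    have hd : 0 < dOf S s :=
      Nat.pos_of_dvd_of_pos (dOf_dvd hs le_rfl) (Nat.pos_of_ne_zero hs0)
    have h := ih (g - dOf S s) (by omega) (s + dOf S s) (hS.2 s hs hs0) (by omega)
      ((dOf_dvd_dOf (Nat.le_add_right _ _)).trans (Nat.dvd_sub hg dvd_rfl))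
    rwa [show s + dOf S s + (g - dOf S s) = s + g by omega] at h

/-- The saturated semigroup generated by `X` together with all integers above `F`. -/
def satHull (F : ℕ) (X : Set ℕ) : Set ℕ := {s | dOf X s ∣ s ∨ F < s}

theorem subset_satHull (F : ℕ) (X : Set ℕ) : X ⊆ satHull F X :=
  fun _ hx => Or.inl (dOf_dvd hx le_rfl)

theorem satHull_mem_SatF {F : ℕ} {X : Set ℕ} (h : ¬ dOf X F ∣ F) : satHull F X ∈ SatF F := by
  refine ⟨⟨⟨Or.inl (dvd_zero _), ?_, ?_⟩, ?_⟩, ?_, ?_⟩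
  · rintro a (ha | ha) b (hb | hb)
    · exact Or.inl (dvd_add ((dOf_dvd_dOf (Nat.le_add_right _ _)).trans ha)
        ((dOf_dvd_dOf (Nat.le_add_left _ _)).trans hb))
    all_goals exact Or.inr (by omega)
  · refine (Set.finite_Iic F).subset fun x hx => ?_
    exact not_lt.1 fun hlt => hx (Or.inr hlt)
  · intro s hs _
    by_cases hsF : F < s
    · exact Or.inr (by omega)
    refine Or.inl ((dOf_dvd_dOf (Nat.le_add_right _ _)).trans
      (dvd_add (hs.resolve_right hsF) (dvd_dOf_iff.2 fun x hx hxs => ?_)))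
    exact (dOf_dvd_dOf hxs).trans (hx.resolve_right (by omega))
  · rintro (h' | h')
    · exact h h'
    · exact lt_irrefl _ h'
  · exact fun x hx => not_lt.1 fun hlt => hx (Or.inr hlt)

theorem subset_SatClosure (F : ℕ) (X : Set ℕ) : X ⊆ SatClosure F X :=
  Set.subset_sInter fun _ hS => hS.2


/-- `{n₁,…,n_p}` is the minimal `Sat(F)`-system of generators
of `Sat(F)[{n₁,…,n_p}]` iff the partial gcds strictly decrease. -/
theorem minimal_generators_iff_gcd_ne (F p : ℕ) (hF : 0 < F) (hp : 0 < p)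
    (n : ℕ → ℕ)
    (hpos : ∀ i, 1 ≤ i → i ≤ p → 0 < n i)
    (hmono : ∀ i, 1 ≤ i → i < p → n i < n (i + 1))
    (hnpF : n p < F)
    (hdF : ¬ (Finset.Icc 1 p).gcd n ∣ F) :
    (∀ Y : Set ℕ, Y ⊆ {x | ∃ i, 1 ≤ i ∧ i ≤ p ∧ x = n i} →
        SatClosure F Y = SatClosure F {x | ∃ i, 1 ≤ i ∧ i ≤ p ∧ x = n i} →
        Y = {x | ∃ i, 1 ≤ i ∧ i ≤ p ∧ x = n i}) ↔
      ∀ i, 1 ≤ i → i < p →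
        (Finset.Icc 1 i).gcd n ≠ (Finset.Icc 1 (i + 1)).gcd n := by
  have hlt : ∀ i j, 1 ≤ i → i < j → j ≤ p → n i < n j := by
    intro i j hi hij
    induction j, hij using Nat.le_induction with
    | base => exact fun hj => hmono i hi hj
    | succ j hj ih => exact fun hjp => (ih (by omega)).trans (hmono j (by omega) hjp)
  have hlt_of : ∀ i j, 1 ≤ i → j ≤ p → n j < n i → j < i := by
    intro i j hi hj h
    by_contra! hij
    rcases hij.eq_or_lt with rfl | hij
    · exact lt_irrefl _ h
    · exact absurd (hlt i j hi hij hj) (by omega)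
  constructor
  · intro hmin i hi hip heq
    have hY := hmin ({x | ∃ i, 1 ≤ i ∧ i ≤ p ∧ x = n i} \ {n (i + 1)}) Set.sdiff_subset ?_
    · have hmem : n (i + 1) ∈ {x | ∃ i, 1 ≤ i ∧ i ≤ p ∧ x = n i} :=
        ⟨i + 1, by omega, hip, rfl⟩
      rw [← hY] at hmem
      exact hmem.2 rfl
    unfold SatClosure
    congr 1
    ext S
    refine and_congr_right fun hS => ⟨fun hYS => ?_, Set.sdiff_subset.trans⟩
    have hj : ∀ j, 1 ≤ j → j ≤ i → n j ∈ S := fun j hj1 hji =>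
      hYS ⟨⟨j, hj1, by omega, rfl⟩, (hlt j (i + 1) hj1 (by omega) hip).ne⟩
    have hle : ∀ j, 1 ≤ j → j ≤ i → n j ≤ n i := fun j hj1 hji => by
      rcases hji.eq_or_lt with rfl | h
      · exact le_rfl
      · exact (hlt j i hj1 h hip.le).le
    have hd : dOf S (n i) ∣ n (i + 1) := by
      have h1 : dOf S (n i) ∣ (Finset.Icc 1 i).gcd n := Finset.dvd_gcd fun j hj' => by
        rw [Finset.mem_Icc] at hj'
        exact dOf_dvd (hj j hj'.1 hj'.2) (hle j hj'.1 hj'.2)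
      rw [heq] at h1
      exact h1.trans (Finset.gcd_dvd (Finset.mem_Icc.2 ⟨by omega, le_rfl⟩))
    have hsucc : n (i + 1) ∈ S := by
      have h := hS.1.add_mem_of_dOf_dvd (n (i + 1) - n i) (n i) (hj i hi le_rfl)
        (hpos i hi hip.le).ne' (Nat.dvd_sub hd (dOf_dvd (hj i hi le_rfl) le_rfl))
      rwa [Nat.add_sub_cancel' (hmono i hi hip).le] at h
    intro x hx
    by_cases hxi : x = n (i + 1)
    · exact hxi ▸ hsucc
    · exact hYS ⟨hx, hxi⟩
  · intro hne Y hYX hYcl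
    refine hYX.antisymm ?_
    rintro _ ⟨i, hi, hip, rfl⟩
    by_contra hiY
    have hF' : ¬ dOf Y F ∣ F := fun h => hdF <| by
      refine (dvd_dOf_iff.2 fun x hx _ => ?_).trans h
      obtain ⟨j, hj1, hjp, rfl⟩ := hYX hx
      exact Finset.gcd_dvd (Finset.mem_Icc.2 ⟨hj1, hjp⟩)
    have hmem : n i ∈ SatClosure F Y := by
      rw [hYcl]
      exact subset_SatClosure F _ ⟨i, hi, hip, rfl⟩
    have hiF : n i < F := by
      rcases hip.eq_or_lt with rfl | h
      · exact hnpF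
      · exact (hlt i p hi h le_rfl).trans hnpF
    have hdvd : dOf Y (n i) ∣ n i :=
      (hmem _ ⟨satHull_mem_SatF hF', subset_satHull F Y⟩).resolve_right (by omega)
    have hprev : (Finset.Icc 1 (i - 1)).gcd n ∣ n i := by
      refine (dvd_dOf_iff.2 fun x hx hxi => ?_).trans hdvd
      obtain ⟨j, hj1, hjp, rfl⟩ := hYX hx
      have hji : j < i := hlt_of i j hi hjp
        (hxi.lt_of_ne fun h => hiY (h ▸ hx))
      exact Finset.gcd_dvd (Finset.mem_Icc.2 ⟨hj1, by omega⟩)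
    rcases hi.eq_or_lt with rfl | hi1
    · exact (hpos 1 le_rfl hip).ne' (by simpa using hprev)
    obtain ⟨k, rfl⟩ : ∃ k, i = k + 1 := ⟨i - 1, by omega⟩
    rw [Nat.add_sub_cancel] at hprev
    refine hne k (by omega) (by omega) (Nat.dvd_antisymm (Finset.dvd_gcd fun j hj => ?_)
      (Finset.gcd_mono (Finset.Icc_subset_Icc_right (by omega))))
    rw [Finset.mem_Icc] at hj
    rcases hj.2.eq_or_lt with rfl | hjk
    · exact hprev
    · exact Finset.gcd_dvd (Finset.mem_Icc.2 ⟨hj.1, by omega⟩)
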